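/- Fix $\gamma > 0$, $B \neq 0$, $d \ge 1$. With $\omega_\theta$, $\alpha_1$, $\alpha_2$, $\beta_2$ as above, define $C_2(t) = \int_{[0,1]^d} \frac{\sin^2(2\pi\theta^1)}{\omega_\theta^2}\,\beta_2(\theta)\,\exp\big(-(\gamma\omega_\theta^2 + \alpha_2(\theta))t\big)\,d\theta$. Then $C_2(t) \sim t^{-d/2-1}$ as $t\to\infty$, in the sense that there exists $C>1$ with $\tfrac{1}{C} t^{-d/2-1} \le C_2(t) \le C t^{-d/2-1}$ for all large $t$. -/

import Mathlib

open Real MeasureTheory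

section Amplitude

variable {γ B w : ℝ}

theorem discriminant_le (hw : 0 ≤ w) :
    √((B^2 - γ^2*w^2 + 4*w)^2 + 4*γ^2*B^2*w^2) ≤ B^2 + γ^2*w^2 + 4*w := by
  rw [Real.sqrt_le_iff]
  refine ⟨by positivity, ?_⟩
  have : 0 ≤ γ^2*w^2*w := by positivity
  nlinarith

theorem le_discriminant (hw : 0 ≤ w) :
    B^2 + γ^2*w^2 - 4*w ≤ √((B^2 - γ^2*w^2 + 4*w)^2 + 4*γ^2*B^2*w^2) := by
  apply Real.le_sqrt_of_sq_le
  have : 0 ≤ B^2*w := by positivity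
  nlinarith

theorem neg_add_discriminant_nonneg :
    0 ≤ (-(B^2 - γ^2*w^2 + 4*w) + √((B^2 - γ^2*w^2 + 4*w)^2 + 4*γ^2*B^2*w^2)) / 2 := by
  have : B^2 - γ^2*w^2 + 4*w ≤ √((B^2 - γ^2*w^2 + 4*w)^2 + 4*γ^2*B^2*w^2) := by
    apply Real.le_sqrt_of_sq_le
    have : 0 ≤ γ^2*B^2*w^2 := by positivity
    linarith
  linarith

theorem weighted_amplitude_bounds (hγ : 0 < γ) (hB : B ≠ 0) {W s t : ℝ} (hw : 0 ≤ w) (hwW : w ≤ W)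
    (hs : 0 ≤ s) (hsw : w = 0 → s = 0) (ht : 0 ≤ t) :
    let S := B^2 - γ^2*w^2 + 4*w
    let D := √(S^2 + 4*γ^2*B^2*w^2)
    let F := s/w * (((S + D)/2 - B^2) / (2*((S + D)/2 + (-S + D)/2))) *
      Real.exp (-(γ*w + √((-S + D)/2))*t)
    2*B^2/((B^2 + γ^2*W^2 + 4*W)*(B^2 + γ^2*W^2)) * (s * Real.exp (-(2*γ*w*t))) ≤ F ∧
      F ≤ 2/B^2 * (s * Real.exp (-(γ*w*t))) := by
  intro S D F
  rcases hw.eq_or_lt with h0 | hw'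
  · simp [F, hsw h0.symm]
  have hB2 : 0 < B^2 := by positivity
  have hDu : D ≤ B^2 + γ^2*w^2 + 4*w := discriminant_le hw
  have hDl : B^2 + γ^2*w^2 - 4*w ≤ D := le_discriminant hw
  have hq0 : 0 ≤ (-S + D)/2 := neg_add_discriminant_nonneg
  have hq1 : (-S + D)/2 ≤ γ^2*w^2 := by simp only [S] at *; linarith
  have hDB : B^2 ≤ D := by simp only [S] at *; linarith
  have hD2 : D^2 = S^2 + 4*γ^2*B^2*w^2 := Real.sq_sqrt (by positivity)
  have hWw : γ^2*w^2 ≤ γ^2*W^2 := by gcongr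
  have hkey : ((S + D)/2 - B^2) * (B^2 + (-S + D)/2) = 4*w*B^2 := by
    have : ((S + D)/2 - B^2) * (B^2 + (-S + D)/2) = (D^2 - S^2)/4 + B^2*S - B^4 := by ring
    rw [this, hD2]; simp only [S]; ring
  have hq0' : 0 < B^2 + (-S + D)/2 := by linarith
  have hD0 : 0 < D := by linarith
  have hb : s/w * (((S + D)/2 - B^2) / (2*((S + D)/2 + (-S + D)/2))) =
      2*B^2/(D*(B^2 + (-S + D)/2)) * s := by
    have : (S + D)/2 - B^2 = 4*w*B^2 / (B^2 + (-S + D)/2) := by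
      rw [eq_div_iff hq0'.ne', hkey]
    rw [this, show 2*((S + D)/2 + (-S + D)/2) = 2*D by ring]
    field_simp
    ring
  have hroot : √((-S + D)/2) ≤ γ*w := by
    rw [Real.sqrt_le_iff]
    exact ⟨by positivity, by rw [mul_pow]; exact hq1⟩
  have hroot0 := Real.sqrt_nonneg ((-S + D)/2)
  have hW : 0 ≤ W := hw.trans hwW
  simp only [F]
  rw [hb, ← mul_assoc, ← mul_assoc]
  constructor
  · gcongr ?_ * s * Real.exp ?_
    · gcongr
      · linarith
      · linarith
    · nlinarith
  · gcongr ?_ * s * Real.exp ?_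
    · rw [div_le_div_iff₀ (by positivity) (by positivity)]
      have : B^2*B^2 ≤ D*(B^2 + (-S + D)/2) := by gcongr; linarith
      linarith
    · nlinarith

end Amplitude

theorem exp_neg_mul_sin_sq_le {s x : ℝ} (hs : 0 ≤ s) (hx0 : 0 ≤ x) (hx1 : x ≤ 1) :
    Real.exp (-(s * Real.sin (π*x)^2)) ≤
      Real.exp (-(4*s) * x^2) + Real.exp (-(4*s) * (x - 1)^2) := by
  have key : ∀ y : ℝ, 0 ≤ y → y ≤ 1/2 →
      Real.exp (-(s * Real.sin (π*y)^2)) ≤ Real.exp (-(4*s) * y^2) := by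
    intro y hy0 hy1
    have h := Real.mul_le_sin (x := π*y) (by positivity) (by nlinarith [Real.pi_pos])
    rw [← mul_assoc, div_mul_cancel₀ _ Real.pi_ne_zero] at h
    have h2 : (2*y)^2 ≤ Real.sin (π*y)^2 := by gcongr
    apply Real.exp_le_exp.2
    nlinarith
  rcases le_total x (1/2) with h | h
  · have := key x hx0 h
    have := Real.exp_pos (-(4*s) * (x - 1)^2)
    linarith
  · have h1 := key (1 - x) (by linarith) (by linarith)
    rw [show π*(1 - x) = π - π*x by ring, Real.sin_pi_sub,
      show (1 - x)^2 = (x - 1)^2 by ring] at h1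
    have := Real.exp_pos (-(4*s) * x^2)
    linarith

theorem integral_exp_neg_mul_sin_sq_le {s : ℝ} (hs : 0 < s) :
    ∫ x in Set.Icc (0:ℝ) 1, Real.exp (-(s * Real.sin (π*x)^2)) ≤ √(π/s) := by
  have hi : Integrable fun x : ℝ => Real.exp (-(4*s) * x^2) :=
    integrable_exp_neg_mul_sq (by positivity)
  have hi' : Integrable fun x : ℝ => Real.exp (-(4*s) * (x - 1)^2) := hi.comp_sub_right 1
  calc ∫ x in Set.Icc (0:ℝ) 1, Real.exp (-(s * Real.sin (π*x)^2))
      ≤ ∫ x in Set.Icc (0:ℝ) 1, (Real.exp (-(4*s) * x^2) + Real.exp (-(4*s) * (x - 1)^2)) := by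
        apply setIntegral_mono_on _ (hi.add hi').integrableOn measurableSet_Icc
        · intro x hx
          exact exp_neg_mul_sin_sq_le hs.le hx.1 hx.2
        · exact (by fun_prop : Continuous _).integrableOn_Icc
    _ ≤ ∫ x : ℝ, (Real.exp (-(4*s) * x^2) + Real.exp (-(4*s) * (x - 1)^2)) :=
        setIntegral_le_integral (hi.add hi') (Filter.Eventually.of_forall fun x => by positivity)
    _ = √(π/s) := by
        rw [integral_add hi hi', integral_sub_right_eq_self (fun x => Real.exp (-(4*s) * x^2)) 1,
          integral_gaussian, show π/(4*s) = (π/s)/2^2 by field_simp; ring,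
          Real.sqrt_div (by positivity), Real.sqrt_sq (by norm_num)]
        ring

theorem integral_cube_exp_neg_mul_sum_sin_sq_le {d : ℕ} {s : ℝ} (hs : 0 < s) :
    ∫ θ in Set.Icc (0 : Fin d → ℝ) 1, Real.exp (-(s * ∑ a, Real.sin (π*θ a)^2)) ≤ √(π/s)^d := by
  have h : ∀ θ : Fin d → ℝ, Real.exp (-(s * ∑ a, Real.sin (π*θ a)^2)) =
      ∏ a, Real.exp (-(s * Real.sin (π*θ a)^2)) := by
    intro θ
    rw [← Real.exp_sum, Finset.mul_sum, Finset.sum_neg_distrib]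
  simp_rw [h]
  rw [← Set.pi_univ_Icc, volume_pi, Measure.restrict_pi_pi,
    integral_fintype_prod_eq_prod (fun _ : Fin d => fun x : ℝ => Real.exp (-(s * Real.sin (π*x)^2)))]
  simp only [Pi.zero_apply, Pi.one_apply, Finset.prod_const, Finset.card_univ, Fintype.card_fin]
  gcongr
  exact integral_exp_neg_mul_sin_sq_le hs

theorem sin_two_pi_mul_sq_le {d : ℕ} (θ : Fin d → ℝ) (i : Fin d) :
    Real.sin (2*π*θ i)^2 ≤ 4 * ∑ a, Real.sin (π*θ a)^2 := by
  have h1 : Real.sin (π*θ i)^2 ≤ ∑ a, Real.sin (π*θ a)^2 :=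
    Finset.single_le_sum (f := fun a => Real.sin (π*θ a)^2) (fun _ _ => sq_nonneg _)
      (Finset.mem_univ i)
  rw [mul_assoc, Real.sin_two_mul]
  nlinarith [sq_nonneg (Real.sin (π*θ i)), mul_nonneg (sq_nonneg (Real.sin (π*θ i)))
    (sub_nonneg.2 (Real.cos_sq_le_one (π*θ i)))]

theorem mul_exp_neg_mul_le {w k : ℝ} (hk : 0 < k) :
    w * Real.exp (-(k*w)) ≤ 2/k * Real.exp (-(k/2*w)) := by
  have h := Real.add_one_le_exp (k/2*w)
  have h2 : Real.exp (-(k*w)) = Real.exp (-(k/2*w)) * Real.exp (-(k/2*w)) := by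
    rw [← Real.exp_add]; ring_nf
  have h3 : w * Real.exp (-(k/2*w)) ≤ 2/k := by
    rw [Real.exp_neg, ← div_eq_mul_inv, div_le_div_iff₀ (Real.exp_pos _) hk]
    linarith
  rw [h2, ← mul_assoc]
  gcongr

theorem box_amplitude_lower_bound {d : ℕ} {r : ℝ} (hr0 : 0 < r) (hr1 : r ≤ 1)
    {θ : Fin d → ℝ} (hθ : ∀ a, r/8 ≤ θ a ∧ θ a ≤ r/4) (i : Fin d) {k : ℝ} (hk : 0 ≤ k) :
    r^2/4 * Real.exp (-(k*(d*π^2))) ≤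
      Real.sin (2*π*θ i)^2 * Real.exp (-(k/r^2*(4 * ∑ a, Real.sin (π*θ a)^2))) := by
  have hpi := Real.pi_pos
  have h1 : (r/2)^2 ≤ Real.sin (2*π*θ i)^2 := by
    obtain ⟨hl, hu⟩ := hθ i
    have hθ0 : 0 ≤ θ i := by linarith
    have h := Real.mul_le_sin (x := 2*π*θ i) (by positivity) (by nlinarith)
    have : 2/π*(2*π*θ i) = 4*θ i := by field_simp; ring
    gcongr
    linarith
  have h2 : ∑ a, Real.sin (π*θ a)^2 ≤ d*(π*(r/4))^2 := by
    have : ∀ a ∈ Finset.univ, Real.sin (π*θ a)^2 ≤ (π*(r/4))^2 := by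
      intro a _
      obtain ⟨hl, hu⟩ := hθ a
      refine (Real.sin_sq_le_sq).trans ?_
      have : 0 ≤ θ a := by linarith
      gcongr
    simpa using Finset.sum_le_card_nsmul _ _ _ this
  have h3 : k/r^2*(4 * ∑ a, Real.sin (π*θ a)^2) ≤ k*(d*π^2) := by
    calc _ ≤ k/r^2*(4*(d*(π*(r/4))^2)) := by gcongr
      _ = k*(d*π^2)/4 := by field_simp
      _ ≤ _ := by
        have : 0 ≤ k*(d*π^2) := by positivity
        linarith
  rw [show r^2/4 = (r/2)^2 by ring]
  gcongr

theorem rpow_neg_half_sub_one (d : ℕ) {t : ℝ} (ht : 0 < t) :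
    t ^ (-(d:ℝ)/2 - 1) = (√t)⁻¹^d * (√t)⁻¹^2 := by
  rw [← pow_add, Real.sqrt_eq_rpow, ← Real.rpow_neg ht.le, ← Real.rpow_natCast, ← Real.rpow_mul ht.le]
  congr 1
  push_cast
  ring

/-- the term C₂(t) behaves as t^{-d/2-1} as t → ∞. -/
theorem stmt5 (γ B : ℝ) (hγ : 0 < γ) (hB : B ≠ 0) (d : ℕ) (hd : 1 ≤ d) :
    let w : (Fin d → ℝ) → ℝ := fun θ => 4 * ∑ a, Real.sin (π * θ a)^2
    let D : (Fin d → ℝ) → ℝ := fun θ =>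
      Real.sqrt ((B^2 - γ^2*(w θ)^2 + 4*(w θ))^2 + 4*γ^2*B^2*(w θ)^2)
    let a1sq : (Fin d → ℝ) → ℝ := fun θ => ((B^2 - γ^2*(w θ)^2 + 4*(w θ)) + D θ)/2
    let a2sq : (Fin d → ℝ) → ℝ := fun θ => (-(B^2 - γ^2*(w θ)^2 + 4*(w θ)) + D θ)/2
    let a2 : (Fin d → ℝ) → ℝ := fun θ => Real.sqrt (a2sq θ)
    let b2 : (Fin d → ℝ) → ℝ := fun θ => (a1sq θ - B^2)/(2*(a1sq θ + a2sq θ))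
    let C2 : ℝ → ℝ := fun t => ∫ θ in Set.Icc (0 : Fin d → ℝ) 1,
      Real.sin (2*π*(θ ⟨0, hd⟩))^2/(w θ) * b2 θ * Real.exp (-(γ * w θ + a2 θ)*t)
    ∃ C : ℝ, 1 < C ∧ ∃ T : ℝ, ∀ t : ℝ, T ≤ t →
      (1/C) * t ^ (-(d:ℝ)/2 - 1) ≤ C2 t ∧ C2 t ≤ C * t ^ (-(d:ℝ)/2 - 1) := by
  intro w D a1sq a2sq a2 b2 C2
  let i : Fin d := ⟨0, hd⟩
  let W : ℝ := 4*d
  let c₁ : ℝ := 2*B^2/((B^2 + γ^2*W^2 + 4*W)*(B^2 + γ^2*W^2))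
  have hB2 : 0 < B^2 := by positivity
  have hc₁ : 0 < c₁ := by positivity
  let f : ℝ → (Fin d → ℝ) → ℝ := fun t θ =>
    Real.sin (2*π*θ i)^2/(w θ) * b2 θ * Real.exp (-(γ * w θ + a2 θ)*t)
  have hw0 : ∀ θ, 0 ≤ w θ := fun θ => by positivity
  have hwW : ∀ θ, w θ ≤ W := by
    intro θ
    have : ∑ a, Real.sin (π*θ a)^2 ≤ d := by
      simpa using Finset.sum_le_card_nsmul Finset.univ (fun a => Real.sin (π*θ a)^2) 1
        (fun a _ => Real.sin_sq_le_one _)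
    simp only [w, W]
    linarith
  have hsw : ∀ θ, Real.sin (2*π*θ i)^2 ≤ w θ := fun θ => sin_two_pi_mul_sq_le θ i
  have hf : ∀ t, 0 ≤ t → ∀ θ,
      c₁ * (Real.sin (2*π*θ i)^2 * Real.exp (-(2*γ*w θ*t))) ≤ f t θ ∧
      f t θ ≤ 2/B^2 * (Real.sin (2*π*θ i)^2 * Real.exp (-(γ*w θ*t))) := fun t ht θ =>
    weighted_amplitude_bounds hγ hB (hw0 θ) (hwW θ) (sq_nonneg _)
      (fun h => le_antisymm (h ▸ hsw θ) (sq_nonneg _)) ht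
  have hf0 : ∀ t, 0 ≤ t → ∀ θ, 0 ≤ f t θ := fun t ht θ =>
    le_trans (by positivity) (hf t ht θ).1
  have hfu : ∀ t, 0 < t → ∀ θ, f t θ ≤
      4/(B^2*γ*t) * Real.exp (-(2*γ*t * ∑ a, Real.sin (π*θ a)^2)) := by
    intro t ht θ
    calc f t θ ≤ 2/B^2 * (w θ * Real.exp (-(γ*t*w θ))) := by
          refine (hf t ht.le θ).2.trans ?_
          rw [mul_right_comm γ]
          gcongr
          exact hsw θ
      _ ≤ 2/B^2 * (2/(γ*t) * Real.exp (-(γ*t/2*w θ))) :=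
          mul_le_mul_of_nonneg_left (mul_exp_neg_mul_le (by positivity)) (by positivity)
      _ = _ := by
          rw [show γ*t/2*w θ = 2*γ*t * ∑ a, Real.sin (π*θ a)^2 by simp only [w]; ring]
          field_simp
          ring
  have hgi : ∀ t, IntegrableOn (fun θ : Fin d → ℝ =>
      4/(B^2*γ*t) * Real.exp (-(2*γ*t * ∑ a, Real.sin (π*θ a)^2))) (Set.Icc 0 1) := fun t =>
    (by fun_prop : Continuous _).continuousOn.integrableOn_compact isCompact_Icc
  have hfi : ∀ t, 0 < t → IntegrableOn (f t) (Set.Icc 0 1) := by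
    intro t ht
    refine (hgi t).mono' ?_ (Filter.Eventually.of_forall fun θ => ?_)
    · refine Measurable.aestronglyMeasurable ?_
      simp only [f, b2, a2, a1sq, a2sq, D, w]
      fun_prop
    · rw [Real.norm_of_nonneg (hf0 t ht.le θ)]
      exact hfu t ht θ
  let Cu : ℝ := 4/(B^2*γ) * √(π/(2*γ))^d
  let Cl : ℝ := c₁ * (1/4 * Real.exp (-(2*γ*(d*π^2)))) * (1/8)^d
  have hCu : 0 < Cu := by positivity
  have hCl : 0 < Cl := by positivity
  refine ⟨1 + Cu + 1/Cl, by linarith [one_div_pos.2 hCl], 1, fun t ht => ?_⟩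
  have ht0 : 0 < t := by linarith
  let r : ℝ := (√t)⁻¹
  have hr0 : 0 < r := by positivity
  have hr1 : r ≤ 1 := inv_le_one_of_one_le₀ (Real.one_le_sqrt.2 ht)
  have hrt : r^2 = 1/t := by simp only [r]; rw [inv_pow, Real.sq_sqrt ht0.le, one_div]
  rw [rpow_neg_half_sub_one d ht0]
  change _ * (r^d*r^2) ≤ ∫ θ in Set.Icc (0 : Fin d → ℝ) 1, f t θ ∧
    ∫ θ in Set.Icc (0 : Fin d → ℝ) 1, f t θ ≤ _ * (r^d*r^2)
  constructor
  · let Q : Set (Fin d → ℝ) := Set.Icc (fun _ => r/8) (fun _ => r/4)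
    have hQ : Q ⊆ Set.Icc 0 1 := Set.Icc_subset_Icc
      (fun a => by change 0 ≤ r/8; positivity) (fun a => by change r/4 ≤ 1; linarith)
    have hvol : volume.real Q = (r/8)^d := by
      rw [Measure.real, Real.volume_Icc_pi_toReal (fun a => by change r/8 ≤ r/4; linarith)]
      simp only [Finset.prod_const, Finset.card_univ, Fintype.card_fin]
      congr 1
      ring
    have hQlt : volume Q ≠ ⊤ := isCompact_Icc.measure_lt_top.ne
    have hlow : ∀ θ ∈ Q, c₁ * (r^2/4 * Real.exp (-(2*γ*(d*π^2)))) ≤ f t θ := by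
      intro θ hθ
      refine le_trans ?_ (hf t ht0.le θ).1
      have h := box_amplitude_lower_bound hr0 hr1 (fun a => ⟨hθ.1 a, hθ.2 a⟩) i
        (k := 2*γ) (by positivity)
      rw [show 2*γ/r^2*(4 * ∑ a, Real.sin (π*θ a)^2) = 2*γ*w θ*t by
        rw [hrt]; simp only [w]; field_simp] at h
      gcongr
    have hC : 1/(1 + Cu + 1/Cl) ≤ Cl := by
      rw [div_le_iff₀ (by positivity), mul_add, mul_one_div_cancel hCl.ne']
      have : 0 ≤ Cl*(1 + Cu) := by positivity
      linarith
    calc 1/(1 + Cu + 1/Cl) * (r^d*r^2) ≤ Cl * (r^d*r^2) := by gcongr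
      _ = c₁ * (r^2/4 * Real.exp (-(2*γ*(d*π^2)))) * volume.real Q := by
          rw [hvol, div_eq_mul_one_div r 8, mul_pow]; simp only [Cl]; ring
      _ ≤ ∫ θ in Q, f t θ := setIntegral_ge_of_const_le_real measurableSet_Icc hQlt hlow
          ((hfi t ht0).mono_set hQ)
      _ ≤ ∫ θ in Set.Icc (0 : Fin d → ℝ) 1, f t θ :=
          setIntegral_mono_set (hfi t ht0) (Filter.Eventually.of_forall (hf0 t ht0.le))
            hQ.eventuallyLE
  · have hsq : √(π/(2*γ*t)) = √(π/(2*γ)) * r := by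
      rw [← div_div, Real.sqrt_div (by positivity), div_eq_mul_inv]
    calc ∫ θ in Set.Icc (0 : Fin d → ℝ) 1, f t θ
        ≤ ∫ θ in Set.Icc (0 : Fin d → ℝ) 1,
            4/(B^2*γ*t) * Real.exp (-(2*γ*t * ∑ a, Real.sin (π*θ a)^2)) :=
          setIntegral_mono (hfi t ht0) (hgi t) (hfu t ht0)
      _ ≤ 4/(B^2*γ*t) * √(π/(2*γ*t))^d := by
          rw [integral_const_mul]
          gcongr
          exact integral_cube_exp_neg_mul_sum_sin_sq_le (by positivity)
      _ = Cu * (r^d*r^2) := by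
          rw [hsq, mul_pow, hrt]; simp only [Cu]; field_simp
      _ ≤ (1 + Cu + 1/Cl) * (r^d*r^2) := by
          gcongr
          linarith [one_div_pos.2 hCl]
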